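/- For any small quantaloid Q, the quantaloid TRSDist(Q) of totally regular Q-semicategories and regular semidistributors is equivalent to the quantaloid Dist(Idm(Q)) of categories and distributors enriched in the split-idempotent completion Idm(Q) of Q. -/

import Mathlib

open CategoryTheory

universe u

variable (Q : Type u) [SmallCategory Q] [∀ X Y : Q, CompleteLattice (X ⟶ Y)]

/-- A (small) quantaloid: a category whose hom-sets are complete lattices and in which
composition distributes on both sides over arbitrary suprema. -/
class IsQuantaloid : Prop where
  comp_sSup : ∀ {X Y Z : Q} (f : X ⟶ Y) (S : Set (Y ⟶ Z)),
      f ≫ sSup S = ⨆ g ∈ S, f ≫ g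
  sSup_comp : ∀ {X Y Z : Q} (S : Set (X ⟶ Y)) (g : Y ⟶ Z),
      sSup S ≫ g = ⨆ f ∈ S, f ≫ g

/-- A `Q`-typed set together with a matrix of hom-arrows.  `A.hom a a' : A.ty a ⟶ A.ty a'`
is the hom-arrow written `A(a',a) : ta → ta'` in the paper. -/
structure QGraph where
  Obj : Type u
  ty : Obj → Q
  hom : ∀ a a' : Obj, ty a ⟶ ty a'

variable {Q}

namespace QGraph

/-- `Q`-semicategory: composition inequality. -/
def IsSemiCat (A : QGraph Q) : Prop :=
  ∀ a a' a'' : A.Obj, A.hom a a' ≫ A.hom a' a'' ≤ A.hom a a''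

/-- Regular `Q`-semicategory. -/
def IsRegular (A : QGraph Q) : Prop :=
  A.IsSemiCat ∧ ∀ a a'' : A.Obj, (⨆ a' : A.Obj, A.hom a a' ≫ A.hom a' a'') = A.hom a a''

/-- Totally regular `Q`-semicategory (elementary characterization):
`A(a,a)∘A(a,a') = A(a,a')` and `A(a',a)∘A(a,a) = A(a',a)`. -/
def IsTR (A : QGraph Q) : Prop :=
  A.IsSemiCat ∧ (∀ a a' : A.Obj, A.hom a a ≫ A.hom a a' = A.hom a a')
    ∧ (∀ a a' : A.Obj, A.hom a' a ≫ A.hom a a = A.hom a' a)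

/-- `Q`-category: composition inequality plus unit inequality. -/
def IsCat (A : QGraph Q) : Prop :=
  A.IsSemiCat ∧ ∀ a : A.Obj, 𝟙 (A.ty a) ≤ A.hom a a

/-- Normal `Q`-category: all endo-hom-arrows are identities. -/
def IsNormal (A : QGraph Q) : Prop :=
  ∀ a : A.Obj, A.hom a a = 𝟙 (A.ty a)

/-- The one-object structure `*_e` on an arrow `e : X ⟶ X`. -/
def single (X : Q) (e : X ⟶ X) : QGraph Q :=
  ⟨PUnit, fun _ => X, fun _ _ => e⟩

/-- Full subgraph determined by a subset of the objects. -/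
def restrict (A : QGraph Q) (s : Set A.Obj) : QGraph Q :=
  ⟨s, fun x => A.ty x, fun x y => A.hom x y⟩

end QGraph

/-- A matrix of `Q`-arrows: `Φ a b : ty a ⟶ ty b` is the paper's `Φ(b,a) : ta → tb`. -/
def QMat (A B : QGraph Q) : Type u :=
  ∀ (a : A.Obj) (b : B.Obj), A.ty a ⟶ B.ty b

/-- Composition of matrices: `(Ψ⊗Φ)(c,a) = ⋁_b Ψ(c,b)∘Φ(b,a)`. -/
def matComp {A B C : QGraph Q} (Φ : QMat A B) (Ψ : QMat B C) : QMat A C :=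
  fun a c => ⨆ b, Φ a b ≫ Ψ b c

/-- (Plain) distributor between `Q`-categories. -/
def IsDist {A B : QGraph Q} (Φ : QMat A B) : Prop :=
  (∀ (a : A.Obj) (b b' : B.Obj), Φ a b ≫ B.hom b b' ≤ Φ a b') ∧
  (∀ (a' a : A.Obj) (b : B.Obj), A.hom a' a ≫ Φ a b ≤ Φ a' b)

/-- Regular semidistributor. -/
def IsRSDist {A B : QGraph Q} (Φ : QMat A B) : Prop :=
  (∀ (a : A.Obj) (b' : B.Obj), (⨆ b, Φ a b ≫ B.hom b b') = Φ a b') ∧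
  (∀ (a' : A.Obj) (b : B.Obj), (⨆ a, A.hom a' a ≫ Φ a b) = Φ a' b)

/-- Adjunction `Φ ⊣ Ψ` (unit and counit inequalities) between matrices. -/
def MatAdj {A B : QGraph Q} (Φ : QMat A B) (Ψ : QMat B A) : Prop :=
  (∀ a a', A.hom a a' ≤ matComp Φ Ψ a a') ∧
  (∀ b b', matComp Ψ Φ b b' ≤ B.hom b b')

/-- A type-preserving object map. -/
structure ObjMap (A B : QGraph Q) where
  map : A.Obj → B.Obj
  ty_eq : ∀ a, B.ty (map a) = A.ty a

namespace ObjMap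

variable {A B C : QGraph Q}

/-- The matrix `B(-,F-)` induced by an object map. -/
def graph (F : ObjMap A B) : QMat A B :=
  fun a b => eqToHom (F.ty_eq a).symm ≫ B.hom (F.map a) b

/-- The matrix `B(F-,-)` induced by an object map. -/
def cograph (F : ObjMap A B) : QMat B A :=
  fun b a => B.hom b (F.map a) ≫ eqToHom (F.ty_eq a)

/-- Semifunctor: `A(a',a) ≤ B(Fa',Fa)`. -/
def IsSemiFun (F : ObjMap A B) : Prop :=
  ∀ a a', A.hom a a' ≤
    eqToHom (F.ty_eq a).symm ≫ B.hom (F.map a) (F.map a') ≫ eqToHom (F.ty_eq a')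

/-- Fully faithful semifunctor: `A(a',a) = B(Fa',Fa)`. -/
def IsFullyFaithful (F : ObjMap A B) : Prop :=
  ∀ a a', A.hom a a' =
    eqToHom (F.ty_eq a).symm ≫ B.hom (F.map a) (F.map a') ≫ eqToHom (F.ty_eq a')

/-- Regular semifunctor: a semifunctor such that `⋁_{a'} B(b,Fa')∘A(a',a) = B(b,Fa)` and
`⋁_{a'} A(a,a')∘B(Fa',b) = B(Fa,b)`. -/
def IsRSFun (F : ObjMap A B) : Prop :=
  F.IsSemiFun ∧
  (∀ a b, (⨆ a', A.hom a a' ≫ F.graph a' b) = F.graph a b) ∧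
  (∀ a b, (⨆ a', F.cograph b a' ≫ A.hom a' a) = F.cograph b a)

/-- Composition of object maps (`G ∘ F`). -/
def comp (F : ObjMap A B) (G : ObjMap B C) : ObjMap A C :=
  ⟨fun a => G.map (F.map a), fun a => (G.ty_eq (F.map a)).trans (F.ty_eq a)⟩

end ObjMap

/-- A left adjoint matrix `Φ` (with right adjoint `Ψ`) converges when it is induced by a
regular semifunctor, i.e. `Φ = B(-,F-)` and `Ψ = B(F-,-)`. -/
def Converges {A B : QGraph Q} (Φ : QMat A B) (Ψ : QMat B A) : Prop :=
  ∃ F : ObjMap A B, F.IsRSFun ∧ (∀ a b, Φ a b = F.graph a b) ∧ (∀ b a, Ψ b a = F.cograph b a)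

/-- Cauchy completeness of a totally regular `Q`-semicategory:
every Cauchy (left adjoint) regular semidistributor into it converges. -/
def CauchyComplete (B : QGraph Q) : Prop :=
  ∀ (A : QGraph Q), A.IsTR → ∀ (Φ : QMat A B) (Ψ : QMat B A),
    IsRSDist Φ → IsRSDist Ψ → MatAdj Φ Ψ → Converges Φ Ψ

/-- Cauchy completeness of a `Q`-category: every left adjoint distributor into it
is induced by a functor. -/
def CatCauchyComplete (B : QGraph Q) : Prop :=
  ∀ (A : QGraph Q), A.IsCat → ∀ (Φ : QMat A B) (Ψ : QMat B A),
    IsDist Φ → IsDist Ψ → MatAdj Φ Ψ →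
    ∃ F : ObjMap A B, F.IsSemiFun ∧ ∀ a b, Φ a b = F.graph a b

/-- An object `a` of a regular `Q`-semicategory is stable when it is the value of a regular
semifunctor on a one-object regular `Q`-semicategory `*_e` (`e` an idempotent). -/
def QGraph.Stable (A : QGraph Q) (a : A.Obj) : Prop :=
  ∃ (X : Q) (e : X ⟶ X), e ≫ e = e ∧
    ∃ F : ObjMap (QGraph.single X e) A, F.IsRSFun ∧ F.map PUnit.unit = a

variable (Q) in
/-- The split-idempotent completion `Idm(Q)`: objects are the idempotent arrows of `Q`. -/
structure Idm where
  obj : Q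
  e : obj ⟶ obj
  idem : e ≫ e = e

/-- Arrows of `Idm(Q)`: `Q`-arrows compatible with the idempotents;
composition and identities as in the paper. -/
instance : SmallCategory (Idm Q) where
  Hom p q := {b : p.obj ⟶ q.obj // p.e ≫ b = b ∧ b ≫ q.e = b}
  id p := ⟨p.e, p.idem, p.idem⟩
  comp f g := ⟨f.1 ≫ g.1,
    by rw [← Category.assoc, f.2.1],
    by rw [Category.assoc, g.2.2]⟩
  id_comp f := Subtype.ext f.2.1
  comp_id f := Subtype.ext f.2.2
  assoc f g h := Subtype.ext (Category.assoc f.1 g.1 h.1)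

instance (p q : Idm Q) : PartialOrder (p ⟶ q) :=
  inferInstanceAs (PartialOrder {b : p.obj ⟶ q.obj // p.e ≫ b = b ∧ b ≫ q.e = b})

variable [IsQuantaloid Q]

instance (p q : Idm Q) : SupSet (p ⟶ q) where
  sSup S := ⟨sSup (Subtype.val '' S), by
    have h : ∀ g ∈ Subtype.val '' S, p.e ≫ g = g := by
      rintro g ⟨b, -, rfl⟩; exact b.2.1
    rw [IsQuantaloid.comp_sSup, sSup_eq_iSup]
    exact biSup_congr h, by
    have h : ∀ g ∈ Subtype.val '' S, g ≫ q.e = g := by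
      rintro g ⟨b, -, rfl⟩; exact b.2.2
    rw [IsQuantaloid.sSup_comp, sSup_eq_iSup]
    exact biSup_congr h⟩

/-- The hom-objects of `Idm(Q)` are complete lattices (local structure inherited from `Q`). -/
instance (p q : Idm Q) : CompleteLattice (p ⟶ q) :=
  completeLatticeOfSup _ (fun S => by
    constructor
    · intro x hx
      show x.1 ≤ sSup (Subtype.val '' S)
      exact le_sSup (Set.mem_image_of_mem _ hx)
    · intro w hw
      show sSup (Subtype.val '' S) ≤ w.1
      apply sSup_le
      rintro g ⟨b, hb, rfl⟩
      exact hw hb)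

/-- The normal `Idm(Q)`-category `Â` associated to a totally regular `Q`-semicategory `A`:
same objects, types `t̂a = A(a,a)` and hom-arrows `Â(a',a) = A(a',a)`. -/
def QGraph.hat (A : QGraph Q) (hA : A.IsTR) : QGraph (Idm Q) where
  Obj := A.Obj
  ty := fun a => ⟨A.ty a, A.hom a a, hA.2.1 a a⟩
  hom := fun a a' => ⟨A.hom a a', hA.2.1 a a', hA.2.2 a' a⟩

section

variable {X Y Z : Q}

theorem IsQuantaloid.comp_iSup {ι : Type*} (f : X ⟶ Y) (g : ι → (Y ⟶ Z)) :
    f ≫ (⨆ i, g i) = ⨆ i, f ≫ g i := by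
  rw [iSup, IsQuantaloid.comp_sSup, iSup_range]

theorem IsQuantaloid.iSup_comp {ι : Type*} (f : ι → (X ⟶ Y)) (g : Y ⟶ Z) :
    (⨆ i, f i) ≫ g = ⨆ i, f i ≫ g := by
  rw [iSup, IsQuantaloid.sSup_comp, iSup_range]

theorem IsQuantaloid.comp_le_comp_left (f : X ⟶ Y) {g h : Y ⟶ Z} (hgh : g ≤ h) :
    f ≫ g ≤ f ≫ h := by
  have key := IsQuantaloid.comp_sSup f {g, h}
  rw [sSup_pair, sup_eq_right.2 hgh, iSup_pair] at key
  exact key ▸ le_sup_left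

theorem IsQuantaloid.comp_le_comp_right {f g : X ⟶ Y} (hfg : f ≤ g) (h : Y ⟶ Z) :
    f ≫ h ≤ g ≫ h := by
  have key := IsQuantaloid.sSup_comp {f, g} h
  rw [sSup_pair, sup_eq_right.2 hfg, iSup_pair] at key
  exact key ▸ le_sup_left

end

theorem QGraph.hat_isCat (A : QGraph Q) (hA : A.IsTR) : (A.hat hA).IsCat :=
  ⟨hA.1, fun _ => le_rfl⟩

section

variable {R : Type u} [SmallCategory R] [∀ X Y : R, CompleteLattice (X ⟶ Y)]
  {A B : QGraph R} {Φ : QMat A B}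

theorem IsRSDist.isDist (hΦ : IsRSDist Φ) : IsDist Φ :=
  ⟨fun a b b' => hΦ.1 a b' ▸ le_iSup (fun b => Φ a b ≫ B.hom b b') b,
    fun a' a b => hΦ.2 a' b ▸ le_iSup (fun a => A.hom a' a ≫ Φ a b) a⟩

theorem IsDist.isRSDist (hΦ : IsDist Φ)
    (hl : ∀ a b, A.hom a a ≫ Φ a b = Φ a b) (hr : ∀ a b, Φ a b ≫ B.hom b b = Φ a b) :
    IsRSDist Φ :=
  ⟨fun a b' => le_antisymm (iSup_le fun b => hΦ.1 a b b')
      (le_iSup_of_le b' (hr a b').ge),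
    fun a' b => le_antisymm (iSup_le fun a => hΦ.2 a' a b)
      (le_iSup_of_le a' (hl a' b).ge)⟩

end

section

variable {A B : QGraph Q} {Φ : QMat A B}

theorem IsRSDist.hom_self_comp (hΦ : IsRSDist Φ) (hA : A.IsTR) (a : A.Obj) (b : B.Obj) :
    A.hom a a ≫ Φ a b = Φ a b := by
  rw [← hΦ.2 a b, IsQuantaloid.comp_iSup]
  simp only [← Category.assoc, hA.2.1]

theorem IsRSDist.comp_hom_self (hΦ : IsRSDist Φ) (hB : B.IsTR) (a : A.Obj) (b : B.Obj) :
    Φ a b ≫ B.hom b b = Φ a b := by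
  rw [← hΦ.1 a b, IsQuantaloid.iSup_comp]
  simp only [Category.assoc, hB.2.2]

end

namespace QGraph

variable (C : QGraph (Idm Q))

/-- The `Q`-graph underlying an `Idm(Q)`-graph. -/
def unhat : QGraph Q where
  Obj := C.Obj
  ty := fun c => (C.ty c).obj
  hom := fun c c' => (C.hom c c').1

variable {C}

theorem IsCat.hom_self_comp (hC : C.IsCat) (c c' : C.Obj) :
    (C.hom c c).1 ≫ (C.hom c c').1 = (C.hom c c').1 :=
  le_antisymm (hC.1 c c c') <|
    calc (C.hom c c').1 = (C.ty c).e ≫ (C.hom c c').1 := (C.hom c c').2.1.symm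
      _ ≤ _ := IsQuantaloid.comp_le_comp_right (Q := Q) (hC.2 c) _

theorem IsCat.comp_hom_self (hC : C.IsCat) (c c' : C.Obj) :
    (C.hom c' c).1 ≫ (C.hom c c).1 = (C.hom c' c).1 :=
  le_antisymm (hC.1 c' c c) <|
    calc (C.hom c' c).1 = (C.hom c' c).1 ≫ (C.ty c).e := (C.hom c' c).2.2.symm
      _ ≤ _ := IsQuantaloid.comp_le_comp_left (Q := Q) _ (hC.2 c)

theorem IsCat.unhat_isTR (hC : C.IsCat) : C.unhat.IsTR :=
  ⟨hC.1, hC.hom_self_comp, hC.comp_hom_self⟩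

/-- The hom-matrix of `C` as a distributor from the hat of its underlying `Q`-graph to `C`. -/
def IsCat.fromHat (hC : C.IsCat) : QMat (C.unhat.hat hC.unhat_isTR) C :=
  fun c c' => ⟨(C.hom c c').1, hC.hom_self_comp c c', (C.hom c c').2.2⟩

/-- The hom-matrix of `C` as a distributor from `C` to the hat of its underlying `Q`-graph. -/
def IsCat.toHat (hC : C.IsCat) : QMat C (C.unhat.hat hC.unhat_isTR) :=
  fun c c' => ⟨(C.hom c c').1, (C.hom c c').2.1, hC.comp_hom_self c' c⟩

theorem IsCat.isDist_fromHat (hC : C.IsCat) : IsDist hC.fromHat :=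
  ⟨hC.1, hC.1⟩

theorem IsCat.isDist_toHat (hC : C.IsCat) : IsDist hC.toHat :=
  ⟨hC.1, hC.1⟩

theorem IsCat.matComp_fromHat_toHat (hC : C.IsCat) (x y : C.Obj) :
    matComp hC.fromHat hC.toHat x y = (C.unhat.hat hC.unhat_isTR).hom x y :=
  le_antisymm (iSup_le fun z => hC.1 x z y)
    (le_iSup_of_le (f := fun z => hC.fromHat x z ≫ hC.toHat z y) x (hC.hom_self_comp x y).ge)

theorem IsCat.matComp_toHat_fromHat (hC : C.IsCat) (x y : C.Obj) :
    matComp hC.toHat hC.fromHat x y = C.hom x y :=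
  le_antisymm (iSup_le (f := fun z => hC.toHat x z ≫ hC.fromHat z y) fun z => hC.1 x z y)
    (le_iSup_of_le (f := fun z => hC.toHat x z ≫ hC.fromHat z y) x (hC.hom_self_comp x y).ge)

end QGraph

/-- the quantaloid `TRSDist(Q)` is equivalent to `Dist(Idm(Q))`: the
homomorphism `(ˆ)` is fully faithful (entrywise bijection and order-isomorphism of the
hom-lattices) and essentially surjective (every `Idm(Q)`-category is isomorphic in
`Dist(Idm(Q))` to some `Â`). -/
theorem TRSDist_equiv_Dist_Idm [IsQuantaloid Q] :
    -- well defined on objects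
    (∀ (A : QGraph Q) (hA : A.IsTR), (A.hat hA).IsCat) ∧
    -- fully faithful
    (∀ (A B : QGraph Q) (hA : A.IsTR) (hB : B.IsTR),
      (∀ Φ : QMat A B, IsRSDist Φ →
        ∃ Θ : QMat (A.hat hA) (B.hat hB), IsDist Θ ∧ ∀ a b, (Θ a b).1 = Φ a b) ∧
      (∀ Θ : QMat (A.hat hA) (B.hat hB), IsDist Θ →
        ∃ Φ : QMat A B, IsRSDist Φ ∧ ∀ a b, (Θ a b).1 = Φ a b) ∧
      (∀ Θ Θ' : QMat (A.hat hA) (B.hat hB), IsDist Θ → IsDist Θ' →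
        ((∀ a b, Θ a b ≤ Θ' a b) ↔ (∀ a b, (Θ a b).1 ≤ (Θ' a b).1)))) ∧
    -- essentially surjective
    (∀ C : QGraph (Idm Q), C.IsCat →
      ∃ (A : QGraph Q) (hA : A.IsTR),
        ∃ (Φ : QMat (A.hat hA) C) (Ψ : QMat C (A.hat hA)), IsDist Φ ∧ IsDist Ψ ∧
          (∀ x y, matComp Φ Ψ x y = (A.hat hA).hom x y) ∧
          (∀ x y, matComp Ψ Φ x y = C.hom x y)) := by
  refine ⟨QGraph.hat_isCat, fun A B hA hB => ⟨fun Φ hΦ => ?_, fun Θ hΘ => ?_, ?_⟩,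
    fun C hC => ?_⟩
  · exact ⟨fun a b => ⟨Φ a b, hΦ.hom_self_comp hA a b, hΦ.comp_hom_self hB a b⟩,
      hΦ.isDist, fun _ _ => rfl⟩
  · refine ⟨fun a b => (Θ a b).1, IsDist.isRSDist ⟨hΘ.1, hΘ.2⟩ ?_ ?_, fun _ _ => rfl⟩
    · exact fun a b => (Θ a b).2.1
    · exact fun a b => (Θ a b).2.2
  · exact fun _ _ _ _ => Iff.rfl
  · exact ⟨C.unhat, hC.unhat_isTR, hC.fromHat, hC.toHat, hC.isDist_fromHat, hC.isDist_toHat,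
      hC.matComp_fromHat_toHat, hC.matComp_toHat_fromHat⟩
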